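/- arXiv:1708.01963 — 3 statements merged into one kernel-verified Lean document; each statement's English description precedes it below -/
import Mathlib

section
/- Let k be an algebraically closed field of characteristic ≠ 2 and let J be a Jordan superalgebra over k with dim J₀ = 1, dim J₁ = 2, such that J₀ = k·e₁ with e₁² = e₁. Then J is isomorphic, as a ℤ/2-graded algebra, to exactly one of the following eight superalgebras on a basis {e₁; o₁, o₂} with e₁ even and o₁, o₂ odd (unlisted products zero): (i) e₁² = e₁ only; (ii) e₁² = e₁, e₁o₂ = (1/2)o₂; (iii) e₁² = e₁, e₁o₂ = o₂; (iv) S₄³: e₁² = e₁, e₁o₁ = o₁, e₁o₂ = (1/2)o₂; (v) S₅³: e₁² = e₁, e₁o₁ = (1/2)o₁, e₁o₂ = (1/2)o₂; (vi) S₆³: e₁² = e₁, e₁o₁ = o₁, e₁o₂ = o₂; (vii) S₇³: e₁² = e₁, e₁o₁ = (1/2)o₁, e₁o₂ = (1/2)o₂, o₁o₂ = e₁; (viii) S₈³: e₁² = e₁, e₁o₁ = o₁, e₁o₂ = o₂, o₁o₂ = e₁. -/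
/-- The sign `(-1)^{|a||b|}` as an element of the field `K`. -/
def sgn (K : Type*) [Field K] (x y : Bool) : K := if x && y then -1 else 1

/-- A Jordan superalgebra over a field `K`: a `K`-vector space with a bilinear
multiplication, a `ℤ/2`-grading `J = J0 ⊕ J1`, super-commutativity and the super
Jordan identity on homogeneous elements. Parity `false` = even, `true` = odd. -/
structure JordanSuperalgebra (K : Type*) [Field K] (J : Type*) [AddCommGroup J]
    [Module K J] where
  mul : J →ₗ[K] J →ₗ[K] J
  J0 : Submodule K J
  J1 : Submodule K J
  compl : IsCompl J0 J1
  grade : ∀ pa pb : Bool, ∀ a ∈ cond pa J1 J0, ∀ b ∈ cond pb J1 J0,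
    mul a b ∈ cond (xor pa pb) J1 J0
  supercomm : ∀ pa pb : Bool, ∀ a ∈ cond pa J1 J0, ∀ b ∈ cond pb J1 J0,
    mul a b = sgn K pa pb • mul b a
  superJordan : ∀ pa pb pc pd : Bool,
    ∀ a ∈ cond pa J1 J0, ∀ b ∈ cond pb J1 J0, ∀ c ∈ cond pc J1 J0, ∀ d ∈ cond pd J1 J0,
    mul (mul a b) (mul c d) + sgn K pb pc • mul (mul a c) (mul b d)
        + (sgn K pb pd * sgn K pc pd) • mul (mul a d) (mul b c)
      = mul (mul (mul a b) c) d + (sgn K pc pd * sgn K pb pc) • mul (mul (mul a d) c) b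
        + (sgn K pa pb * sgn K pa pc * sgn K pa pd * sgn K pc pd) • mul (mul (mul b d) c) a

namespace JordanSuperalgebra

variable {K : Type*} [Field K] {J : Type*} [AddCommGroup J] [Module K J]

/-- `f` is an idempotent spanning the even part, `w₁, w₂` is a basis of the odd part, and the
products are `f w₁ = a w₁`, `f w₂ = b w₂`, `w₁ w₂ = c f`. -/
def HasTable (S : JordanSuperalgebra K J) (f w₁ w₂ : J) (a b c : K) : Prop :=
  S.J0 = Submodule.span K {f} ∧ f ≠ 0 ∧ S.mul f f = f ∧
    S.J1 = Submodule.span K {w₁, w₂} ∧ LinearIndependent K ![w₁, w₂] ∧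
    S.mul f w₁ = a • w₁ ∧ S.mul w₁ f = a • w₁ ∧
    S.mul f w₂ = b • w₂ ∧ S.mul w₂ f = b • w₂ ∧
    S.mul w₁ w₂ = c • f ∧ S.mul w₂ w₁ = -(c • f) ∧
    S.mul w₁ w₁ = 0 ∧ S.mul w₂ w₂ = 0

variable {S : JordanSuperalgebra K J}

theorem mul_odd_even {x y : J} (hx : x ∈ S.J1) (hy : y ∈ S.J0) : S.mul x y = S.mul y x := by
  simpa [sgn] using S.supercomm true false x hx y hy

theorem mul_odd_odd {x y : J} (hx : x ∈ S.J1) (hy : y ∈ S.J1) : S.mul x y = -S.mul y x := by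
  simpa [sgn] using S.supercomm true true x hx y hy

theorem mul_odd_self (h2 : (2 : K) ≠ 0) {x : J} (hx : x ∈ S.J1) : S.mul x x = 0 := by
  have h : (2 : K) • S.mul x x = 0 := by
    rw [two_smul]
    nth_rewrite 1 [mul_odd_odd hx hx]
    simp
  exact (smul_eq_zero.mp h).resolve_left h2

theorem mul_even_odd_mem {x y : J} (hx : x ∈ S.J0) (hy : y ∈ S.J1) : S.mul x y ∈ S.J1 := by
  simpa using S.grade false true x hx y hy

/-- The cubic equation satisfied by the action of an even idempotent on the odd part. -/
theorem idempotent_cubic {e w : J} (he : e ∈ S.J0) (hsq : S.mul e e = e) (hw : w ∈ S.J1) :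
    (2 : K) • S.mul e (S.mul e (S.mul e w))
      = (3 : K) • S.mul e (S.mul e w) - S.mul e w := by
  have h := S.superJordan false false false true e he e he e he w hw
  have h1 := mul_even_odd_mem he hw
  have h2 := mul_even_odd_mem he h1
  simp only [sgn, Bool.false_and, Bool.and_false, Bool.false_eq_true, if_false, hsq,
    mul_one, one_smul, mul_odd_even h1 he, mul_odd_even h2 he] at h
  linear_combination (norm := module) -h

/-- The relation forced by a nonzero product of two odd eigenvectors. -/
theorem idempotent_product {e u v : J} {a b c : K} (he : e ∈ S.J0) (hne : e ≠ 0)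
    (hsq : S.mul e e = e) (hu : u ∈ S.J1) (hv : v ∈ S.J1) (heu : S.mul e u = a • u)
    (hev : S.mul e v = b • v) (huv : S.mul u v = c • e) :
    c * (1 + 2 * a * b) = c * (a + 2 * b) := by
  have h := S.superJordan false false true true e he e he u hu v hv
  have hvu : S.mul v u = -(c • e) := by rw [mul_odd_odd hv hu, huv]
  simp only [sgn, Bool.false_and, Bool.and_self, Bool.false_eq_true, if_false,
    if_true, hsq, mul_one, one_mul, one_smul, heu, hev, huv, hvu, map_smul, map_neg,
    LinearMap.smul_apply, LinearMap.neg_apply] at h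
  refine smul_left_injective K hne ?_
  simp only
  linear_combination (norm := module) h

namespace HasTable

variable {f w₁ w₂ : J} {a b c : K}

theorem swap (h : S.HasTable f w₁ w₂ a b c) : S.HasTable f w₂ w₁ b a (-c) := by
  obtain ⟨h0, hf, hff, h1, hli, e1, e1', e2, e2', p, p', q1, q2⟩ := h
  refine ⟨h0, hf, hff, by rw [h1, Set.pair_comm], ?_, e2, e2', e1, e1', by simp [p'],
    by simp [p], q2, q1⟩
  exact LinearIndependent.pair_symm_iff.mp hli

theorem normalize (h : S.HasTable f w₁ w₂ a b c) (hc : c ≠ 0) :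
    S.HasTable f w₁ (c⁻¹ • w₂) a b 1 := by
  obtain ⟨h0, hf, hff, h1, hli, e1, e1', e2, e2', p, p', q1, q2⟩ := h
  refine ⟨h0, hf, hff, ?_, ?_, e1, e1', ?_, ?_, ?_, ?_, q1, ?_⟩
  · rw [h1, Submodule.span_insert, Submodule.span_insert,
      Submodule.span_singleton_smul_eq (IsUnit.mk0 _ (inv_ne_zero hc))]
  · rw [LinearIndependent.pair_iff] at hli ⊢
    intro s t hst
    rw [smul_smul] at hst
    obtain ⟨rfl, ht⟩ := hli _ _ hst
    exact ⟨rfl, (mul_eq_zero.mp ht).resolve_right (inv_ne_zero hc)⟩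
  · rw [map_smul, e2, smul_comm]
  · rw [map_smul, LinearMap.smul_apply, e2', smul_comm]
  · rw [map_smul, p, smul_smul, inv_mul_cancel₀ hc]
  · rw [map_smul, LinearMap.smul_apply, p', smul_neg, smul_smul, inv_mul_cancel₀ hc]
  · simp [q2]

theorem eq_of_idempotent {e : J} (h : S.HasTable f w₁ w₂ a b c) (he : e ∈ S.J0) (hne : e ≠ 0)
    (hsq : S.mul e e = e) : f = e := by
  obtain ⟨h0, hf, hff, -⟩ := h
  rw [h0, Submodule.mem_span_singleton] at he
  obtain ⟨t, rfl⟩ := he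
  simp only [map_smul, LinearMap.smul_apply, hff, smul_smul] at hsq
  have ht : t ≠ 0 := by rintro rfl; simp at hne
  have : t * t = t := smul_left_injective K hf hsq
  rw [mul_right_cancel₀ ht (this.trans (one_mul t).symm), one_smul]

/-- The parameters `a` and `b` are the eigenvalues of `f` on the odd part. -/
theorem eigenvalue_iff (h : S.HasTable f w₁ w₂ a b c) (v : K) :
    (∃ w ∈ S.J1, w ≠ 0 ∧ S.mul f w = v • w) ↔ a = v ∨ b = v := by
  obtain ⟨h0, hf, hff, h1, hli, e1, e1', e2, e2', -⟩ := h
  constructor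
  · rintro ⟨w, hw, hw0, hv⟩
    rw [h1, Submodule.mem_span_pair] at hw
    obtain ⟨s, t, rfl⟩ := hw
    simp only [map_add, map_smul, e1, e2] at hv
    obtain ⟨h1, h2⟩ := LinearIndependent.pair_iff.mp hli ((a - v) * s) ((b - v) * t)
      (by linear_combination (norm := module) hv)
    by_contra! hab
    rw [mul_eq_zero, sub_eq_zero] at h1 h2
    simp [h1.resolve_left hab.1, h2.resolve_left hab.2] at hw0
  · rintro (rfl | rfl)
    · exact ⟨w₁, h1 ▸ Submodule.subset_span (by simp), hli.ne_zero 0, e1⟩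
    · exact ⟨w₂, h1 ▸ Submodule.subset_span (by simp), hli.ne_zero 1, e2⟩

theorem product_iff (h : S.HasTable f w₁ w₂ a b c) :
    (∃ x ∈ S.J1, ∃ y ∈ S.J1, S.mul x y ≠ 0) ↔ c ≠ 0 := by
  obtain ⟨h0, hf, hff, h1, hli, e1, e1', e2, e2', p, p', q1, q2⟩ := h
  constructor
  · rintro ⟨x, hx, y, hy, hxy⟩ rfl
    rw [h1, Submodule.mem_span_pair] at hx hy
    obtain ⟨s, t, rfl⟩ := hx
    obtain ⟨s', t', rfl⟩ := hy
    simp [p, p', q1, q2] at hxy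
  · intro hc
    exact ⟨w₁, h1 ▸ Submodule.subset_span (by simp), w₂, h1 ▸ Submodule.subset_span (by simp),
      by simp [p, hc, hf]⟩

end HasTable

/-- The odd part has a basis of eigenvectors of the even idempotent. -/
theorem exists_hasTable (h2 : (2 : K) ≠ 0) {e : J} (hJ0 : S.J0 = Submodule.span K {e})
    (hne : e ≠ 0) (hsq : S.mul e e = e) (h1 : Module.finrank K S.J1 = 2) :
    ∃ (w₁ w₂ : J) (a b c : K), (a = 0 ∨ a = 1 / 2 ∨ a = 1) ∧ (b = 0 ∨ b = 1 / 2 ∨ b = 1) ∧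
      (c ≠ 0 → a = b ∧ a ≠ 0) ∧ S.HasTable e w₁ w₂ a b c := by
  have he : e ∈ S.J0 := hJ0 ▸ Submodule.mem_span_singleton_self e
  set s : Set J := {w | w ∈ S.J1 ∧ ∃ a : K, (a = 0 ∨ a = 1 / 2 ∨ a = 1) ∧ S.mul e w = a • w}
  have hs : Submodule.span K s = S.J1 := by
    refine le_antisymm (Submodule.span_le.mpr fun w hw => hw.1) fun w hw => ?_
    have hw1 := mul_even_odd_mem he hw
    have hw2 := mul_even_odd_mem he hw1
    have hcub := idempotent_cubic he hsq hw
    have key : w = (w - (3 : K) • S.mul e w + (2 : K) • S.mul e (S.mul e w))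
        + (4 : K) • (S.mul e w - S.mul e (S.mul e w))
        + ((2 : K) • S.mul e (S.mul e w) - S.mul e w) := by module
    rw [key]
    refine add_mem (add_mem (Submodule.subset_span ⟨?_, 0, by simp, ?_⟩)
      (Submodule.smul_mem _ _ (Submodule.subset_span ⟨?_, 1 / 2, by simp, ?_⟩)))
      (Submodule.subset_span ⟨?_, 1, by simp, ?_⟩)
    · exact add_mem (sub_mem hw (Submodule.smul_mem _ _ hw1)) (Submodule.smul_mem _ _ hw2)
    · simp only [map_add, map_sub, map_smul, hcub]
      module
    · exact sub_mem hw1 hw2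
    · refine smul_right_injective J h2 ?_
      simp only [map_sub, smul_sub, hcub, smul_smul, mul_one_div_cancel h2]
      module
    · exact sub_mem (Submodule.smul_mem _ _ hw2) hw1
    · simp only [map_sub, map_smul, hcub]
      module
  have hfin : Module.finrank K (Submodule.span K s) = 2 := by rw [hs, h1]
  have : FiniteDimensional K (Submodule.span K s) :=
    Module.finite_of_finrank_pos (by omega)
  obtain ⟨g, hg, hspan, hli⟩ := Submodule.exists_fun_fin_finrank_span_eq K s
  revert g
  rw [hfin]
  intro g hg hspan hli
  obtain ⟨hu, a, ha, hea⟩ := hg 0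
  obtain ⟨hv, b, hb, heb⟩ := hg 1
  have hg01 : g = ![g 0, g 1] := by ext i; fin_cases i <;> rfl
  have hprod : S.mul (g 0) (g 1) ∈ S.J0 := by simpa using S.grade true true _ hu _ hv
  rw [hJ0, Submodule.mem_span_singleton] at hprod
  obtain ⟨c, hc⟩ := hprod
  have hvu : S.mul (g 1) (g 0) = -(c • e) := by rw [mul_odd_odd hv hu, hc]
  refine ⟨g 0, g 1, a, b, c, ha, hb, fun hc0 => ?_, hJ0, hne, hsq, ?_, hg01 ▸ hli, hea,
    (mul_odd_even hu he).trans hea, heb, (mul_odd_even hv he).trans heb, hc.symm, hvu,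
    mul_odd_self h2 hu, mul_odd_self h2 hv⟩
  · have r1 := mul_left_cancel₀ hc0 (idempotent_product he hne hsq hu hv hea heb hc.symm)
    have r2 := mul_left_cancel₀ (neg_ne_zero.mpr hc0)
      (idempotent_product he hne hsq hv hu heb hea (by rw [hvu, neg_smul]))
    have hab : a = b := by linear_combination r1 - r2
    refine ⟨hab, ?_⟩
    rintro rfl
    simp [← hab] at r1
  · rw [← hs, ← hspan, hg01]
    simp [Matrix.range_cons, Matrix.range_empty, Set.pair_comm]

end JordanSuperalgebra

/-- Classification of Jordan superalgebras of type `(1,2)` whose even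
part is `U₁` (so `e₁² = e₁`), over an algebraically closed field of characteristic ≠ 2:
exactly one of the eight tables `e₁o₁ = a·o₁`, `e₁o₂ = b·o₂`, `o₁o₂ = c·e₁` with
`(a,b,c)` in `{(0,0,0), (0,1/2,0), (0,1,0), (1,1/2,0), (1/2,1/2,0), (1,1,0),
(1/2,1/2,1), (1,1,1)}` is realized by a homogeneous basis. -/
theorem classification_type_one_two_idem (K : Type) [Field K] [IsAlgClosed K]
    (h2 : (2 : K) ≠ 0)
    (J : Type) [AddCommGroup J] [Module K J] (S : JordanSuperalgebra K J)
    (e : J) (hJ0 : S.J0 = Submodule.span K {e}) (hne : e ≠ 0)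
    (hsq : S.mul e e = e) (h1 : Module.finrank K S.J1 = 2) :
    ∃! p : Fin 8, ∃ f w₁ w₂ : J,
      S.J0 = Submodule.span K {f} ∧ f ≠ 0 ∧ S.mul f f = f ∧
      S.J1 = Submodule.span K {w₁, w₂} ∧ LinearIndependent K ![w₁, w₂] ∧
      S.mul f w₁ = (![(0 : K), 0, 0, 1, 1/2, 1, 1/2, 1] p) • w₁ ∧
      S.mul w₁ f = (![(0 : K), 0, 0, 1, 1/2, 1, 1/2, 1] p) • w₁ ∧
      S.mul f w₂ = (![(0 : K), 1/2, 1, 1/2, 1/2, 1, 1/2, 1] p) • w₂ ∧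
      S.mul w₂ f = (![(0 : K), 1/2, 1, 1/2, 1/2, 1, 1/2, 1] p) • w₂ ∧
      S.mul w₁ w₂ = (![(0 : K), 0, 0, 0, 0, 0, 1, 1] p) • f ∧
      S.mul w₂ w₁ = -((![(0 : K), 0, 0, 0, 0, 0, 1, 1] p) • f) ∧
      S.mul w₁ w₁ = 0 ∧ S.mul w₂ w₂ = 0 := by
  have he : e ∈ S.J0 := hJ0 ▸ Submodule.mem_span_singleton_self e
  have half0 : (2 : K)⁻¹ ≠ 0 := inv_ne_zero h2
  have half1 : (2 : K)⁻¹ ≠ 1 := fun h => by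
    have h' : (2 : K) = 1 := by simpa using h
    exact one_ne_zero (α := K) (by linear_combination h')
  change ∃! p : Fin 8, ∃ f w₁ w₂ : J, S.HasTable f w₁ w₂ (![(0 : K), 0, 0, 1, 1/2, 1, 1/2, 1] p)
    (![(0 : K), 1/2, 1, 1/2, 1/2, 1, 1/2, 1] p) (![(0 : K), 0, 0, 0, 0, 0, 1, 1] p)
  refine existsUnique_of_exists_of_unique ?_ ?_
  · obtain ⟨w₁, w₂, a, b, c, ha, hb, hc, h⟩ := S.exists_hasTable h2 hJ0 hne hsq h1
    by_cases hc0 : c = 0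
    · subst hc0
      have h' := h.swap
      rw [neg_zero] at h'
      rcases ha with rfl | rfl | rfl <;> rcases hb with rfl | rfl | rfl
      · exact ⟨0, e, w₁, w₂, h⟩
      · exact ⟨1, e, w₁, w₂, h⟩
      · exact ⟨2, e, w₁, w₂, h⟩
      · exact ⟨1, e, w₂, w₁, h'⟩
      · exact ⟨4, e, w₁, w₂, h⟩
      · exact ⟨3, e, w₂, w₁, h'⟩
      · exact ⟨2, e, w₂, w₁, h'⟩
      · exact ⟨3, e, w₁, w₂, h⟩
      · exact ⟨5, e, w₁, w₂, h⟩
    · obtain ⟨rfl, ha0⟩ := hc hc0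
      rcases ha with rfl | rfl | rfl
      · exact absurd rfl ha0
      · exact ⟨6, e, w₁, _, h.normalize hc0⟩
      · exact ⟨7, e, w₁, _, h.normalize hc0⟩
  · rintro p q ⟨f, w₁, w₂, hp⟩ ⟨f', w₁', w₂', hq⟩
    obtain rfl := hp.eq_of_idempotent he hne hsq
    obtain rfl := hq.eq_of_idempotent he hne hsq
    have hev v := (hp.eigenvalue_iff v).symm.trans (hq.eigenvalue_iff v)
    have hpr := hp.product_iff.symm.trans hq.product_iff
    have v0 := hev 0
    have vh := hev 2⁻¹
    have v1 := hev 1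
    clear hev hp hq
    fin_cases p <;> fin_cases q <;> first
      | rfl
      | (exfalso
         simp [half0, half1, half0.symm, half1.symm] at v0 vh v1 hpr)
end

section
/- Let k be an algebraically closed field of characteristic ≠ 2 and let J be a Jordan superalgebra over k with dim J₀ = 2, dim J₁ = 1, such that J₀ has a basis {e₁, e₂} with e₁² = e₁, e₁e₂ = (1/2)e₂, e₂² = 0 (J₀ is the Jordan algebra B₂). Then, writing J₁ = k·o₁, one has e₂o₁ = 0, and J is isomorphic as a ℤ/2-graded algebra to exactly one of: (i) B₂ˢ ⊕ S₁¹: e₁o₁ = 0; (ii) S₁₁³: e₁o₁ = (1/2)o₁; (iii) S₁₂³: e₁o₁ = o₁. -/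
namespace JordanSuperalgebra

variable {K : Type*} [Field K] {J : Type*} [AddCommGroup J] [Module K J]

/-- Even elements commute with odd elements. -/
lemma mul_odd_even_s15 (S : JordanSuperalgebra K J) {a o : J} (ha : a ∈ S.J0) (ho : o ∈ S.J1) :
    S.mul o a = S.mul a o := by
  simpa [sgn] using S.supercomm true false o ho a ha

/-- The square of an odd element vanishes. -/
lemma mul_self_odd (S : JordanSuperalgebra K J) (h2 : (2 : K) ≠ 0) {o : J} (ho : o ∈ S.J1) :
    S.mul o o = 0 := by
  have h : S.mul o o = -S.mul o o := by simpa [sgn] using S.supercomm true true o ho o ho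
  have h' : (2 : K) • S.mul o o = 0 := by
    rw [two_smul]
    exact eq_neg_iff_add_eq_zero.mp h
  exact (smul_eq_zero.mp h').resolve_left h2

/-- The super Jordan identity for one even element, repeated three times, and an odd one. -/
lemma jordan_even_cube_odd (S : JordanSuperalgebra K J) {a o : J} (ha : a ∈ S.J0)
    (ho : o ∈ S.J1) :
    (3 : K) • S.mul (S.mul a a) (S.mul a o) =
      S.mul (S.mul (S.mul a a) a) o + (2 : K) • S.mul a (S.mul a (S.mul a o)) := by
  have hao : S.mul a o ∈ S.J1 := S.grade false true a ha o ho
  have haao : S.mul a (S.mul a o) ∈ S.J1 := S.grade false true a ha _ hao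
  have haa : S.mul a a ∈ S.J0 := S.grade false false a ha a ha
  have h := S.superJordan false false false true a ha a ha a ha o ho
  simp only [sgn, Bool.false_and, Bool.and_false, Bool.false_eq_true, if_false, one_smul,
    mul_one] at h
  rw [S.mul_odd_even_s15 haa hao, S.mul_odd_even_s15 ha hao, S.mul_odd_even_s15 ha haao] at h
  linear_combination (norm := module) h

/-- An idempotent acts on an odd eigenvector with eigenvalue `0`, `1/2` or `1`. -/
lemma eigenvalue_of_idempotent (S : JordanSuperalgebra K J) (h2 : (2 : K) ≠ 0) {e o : J} {b : K}
    (he : e ∈ S.J0) (ho : o ∈ S.J1) (ho0 : o ≠ 0) (hee : S.mul e e = e)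
    (heo : S.mul e o = b • o) : b = 0 ∨ b = 1 / 2 ∨ b = 1 := by
  have h := S.jordan_even_cube_odd he ho
  simp only [hee, heo, map_smul, smul_smul] at h
  rw [← add_smul] at h
  have hb : b * ((2 * b - 1) * (b - 1)) = 0 := by
    linear_combination -(smul_left_injective K ho0 h)
  rcases mul_eq_zero.mp hb with h0 | h0
  · exact Or.inl h0
  rcases mul_eq_zero.mp h0 with h0 | h0
  · exact Or.inr (Or.inl (by field_simp; linear_combination h0))
  · exact Or.inr (Or.inr (sub_eq_zero.mp h0))

/-- A square-zero even element annihilates its odd eigenvectors. -/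
lemma mul_eq_zero_of_sq_eq_zero (S : JordanSuperalgebra K J) (h2 : (2 : K) ≠ 0) {n o : J} {c : K}
    (hn : n ∈ S.J0) (ho : o ∈ S.J1) (hnn : S.mul n n = 0) (hno : S.mul n o = c • o) :
    S.mul n o = 0 := by
  have h := S.jordan_even_cube_odd hn ho
  simp only [hnn, hno, map_smul, map_zero, LinearMap.zero_apply, smul_zero, zero_add,
    smul_smul] at h
  rcases smul_eq_zero.mp h.symm with hc | hc
  · have : c = 0 := by simpa [h2] using hc
    rw [hno, this, zero_smul]
  · rw [hno, hc, smul_zero]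

/-- Every nonzero idempotent in the span of the standard basis of `B₂` has first coordinate `1`. -/
lemma exists_eq_add_smul_of_idempotent (S : JordanSuperalgebra K J) (h2 : (2 : K) ≠ 0)
    {e n f : J} (hli : LinearIndependent K ![e, n])
    (hee : S.mul e e = e) (hen : S.mul e n = (1 / 2 : K) • n)
    (hne : S.mul n e = (1 / 2 : K) • n) (hnn : S.mul n n = 0)
    (hf : f ∈ Submodule.span K {e, n}) (hff : S.mul f f = f) (hf0 : f ≠ 0) :
    ∃ y : K, f = e + y • n := by
  obtain ⟨x, y, rfl⟩ := Submodule.mem_span_pair.mp hf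
  have hmul : S.mul (x • e + y • n) (x • e + y • n) = (x * x) • e + (x * y) • n := by
    simp only [map_add, map_smul, LinearMap.add_apply, LinearMap.smul_apply, hee, hen, hne, hnn]
    match_scalars <;> field_simp
    ring
  rw [hmul] at hff
  obtain ⟨hx, hy⟩ := LinearIndependent.pair_iff.mp hli (x * x - x) (x * y - y) (by
    linear_combination (norm := module) hff)
  have hx' : x * (x - 1) = 0 := by linear_combination hx
  rcases mul_eq_zero.mp hx' with h | h
  · subst h
    have : y = 0 := by linear_combination -hy
    simp [this] at hf0
  · exact ⟨y, by rw [sub_eq_zero.mp h, one_smul]⟩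

end JordanSuperalgebra

/-- Classification of Jordan superalgebras of type `(2,1)` whose even
part is `B₂` (`e₁² = e₁`, `e₁e₂ = (1/2)e₂`, `e₂² = 0`), over an algebraically closed
field of characteristic ≠ 2: one has `e₂o₁ = 0`, and exactly one of the tables
`e₁o₁ = β·o₁` with `β ∈ {0, 1/2, 1}` is realized by a homogeneous basis. -/
theorem classification_type_two_one_B2 (K : Type) [Field K] [IsAlgClosed K]
    (h2 : (2 : K) ≠ 0)
    (J : Type) [AddCommGroup J] [Module K J] (S : JordanSuperalgebra K J)
    (e₁ e₂ o₁ : J)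
    (hJ0 : S.J0 = Submodule.span K {e₁, e₂}) (hli : LinearIndependent K ![e₁, e₂])
    (hJ1 : S.J1 = Submodule.span K {o₁}) (ho : o₁ ≠ 0)
    (h11 : S.mul e₁ e₁ = e₁) (h12 : S.mul e₁ e₂ = (1/2 : K) • e₂)
    (h21 : S.mul e₂ e₁ = (1/2 : K) • e₂) (h22 : S.mul e₂ e₂ = 0) :
    S.mul e₂ o₁ = 0 ∧
    (∃! p : Fin 3, ∃ f₁ f₂ w : J,
      S.J0 = Submodule.span K {f₁, f₂} ∧ LinearIndependent K ![f₁, f₂] ∧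
      S.J1 = Submodule.span K {w} ∧ w ≠ 0 ∧
      S.mul f₁ f₁ = f₁ ∧ S.mul f₁ f₂ = (1/2 : K) • f₂ ∧
      S.mul f₂ f₁ = (1/2 : K) • f₂ ∧ S.mul f₂ f₂ = 0 ∧
      S.mul f₁ w = (![(0 : K), 1/2, 1] p) • w ∧
      S.mul w f₁ = (![(0 : K), 1/2, 1] p) • w ∧
      S.mul f₂ w = 0 ∧ S.mul w f₂ = 0 ∧ S.mul w w = 0) := by
  have he₁ : e₁ ∈ S.J0 := hJ0 ▸ Submodule.subset_span (by simp)
  have he₂ : e₂ ∈ S.J0 := hJ0 ▸ Submodule.subset_span (by simp)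
  have ho₁ : o₁ ∈ S.J1 := hJ1 ▸ Submodule.mem_span_singleton_self o₁
  have heigen : ∀ a ∈ S.J0, ∃ b : K, S.mul a o₁ = b • o₁ := fun a ha ↦ by
    have h : S.mul a o₁ ∈ S.J1 := S.grade false true a ha o₁ ho₁
    rw [hJ1] at h
    obtain ⟨b, hb⟩ := Submodule.mem_span_singleton.mp h
    exact ⟨b, hb.symm⟩
  obtain ⟨b, hb⟩ := heigen e₁ he₁
  obtain ⟨c, hc⟩ := heigen e₂ he₂
  have h2o : S.mul e₂ o₁ = 0 := S.mul_eq_zero_of_sq_eq_zero h2 he₂ ho₁ h22 hc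
  have hp : ∃ p : Fin 3, b = (![(0 : K), 1/2, 1] p) := by
    rcases S.eigenvalue_of_idempotent h2 he₁ ho₁ ho h11 hb with h | h | h
    · exact ⟨0, h⟩
    · exact ⟨1, h⟩
    · exact ⟨2, h⟩
  have hinj : Function.Injective ![(0 : K), 1/2, 1] := by
    have h12' : (1 / 2 : K) ≠ 1 := by
      intro h
      field_simp at h
      exact one_ne_zero (α := K) (by linear_combination -h)
    intro p q hpq
    fin_cases p <;> fin_cases q <;> simp_all
  obtain ⟨p, rfl⟩ := hp
  refine ⟨h2o, p, ⟨e₁, e₂, o₁, hJ0, hli, hJ1, ho, h11, h12, h21, h22, hb, ?_, h2o, ?_,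
    S.mul_self_odd h2 ho₁⟩, ?_⟩
  · rw [S.mul_odd_even_s15 he₁ ho₁, hb]
  · rw [S.mul_odd_even_s15 he₂ ho₁, h2o]
  · rintro q ⟨f₁, f₂, w, hf, hfli, hw, hw0, hff, -, -, -, hfw, -⟩
    have hf₁ : f₁ ∈ Submodule.span K {e₁, e₂} :=
      hJ0 ▸ hf ▸ Submodule.subset_span (by simp)
    have hw₁ : w ∈ Submodule.span K {o₁} := hJ1 ▸ hw ▸ Submodule.mem_span_singleton_self w
    obtain ⟨y, rfl⟩ := S.exists_eq_add_smul_of_idempotent h2 hli h11 h12 h21 h22 hf₁ hff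
      (hfli.ne_zero 0)
    obtain ⟨z, rfl⟩ := Submodule.mem_span_singleton.mp hw₁
    refine hinj (smul_left_injective K hw0 ?_)
    simp only [← hfw, map_add, map_smul, LinearMap.add_apply, LinearMap.smul_apply, hb, h2o,
      smul_zero, add_zero]
    exact smul_comm _ _ _
end

section
/- Let k be an algebraically closed field of characteristic ≠ 2 and let J be a Jordan superalgebra over k with dim J₀ = 2, dim J₁ = 1, such that J₀ has a basis {e₁, e₂} of orthogonal idempotents: e₁² = e₁, e₂² = e₂, e₁e₂ = 0 (J₀ = U₁ ⊕ U₁). Then, writing J₁ = k·o₁, J is isomorphic as a ℤ/2-graded algebra to exactly one of the four superalgebras given by (e₁o₁, e₂o₁) = (0, 0), ((1/2)o₁, 0), (o₁, 0), or ((1/2)o₁, (1/2)o₁); the last one is the indecomposable superalgebra S₁₃³. -/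
open Submodule in
/-- Two independent vectors that are orthogonal idempotents for a bilinear product form the only
such pair in their span, up to order. -/
theorem eq_or_swap_of_orthogonal_idempotents {K J : Type*} [Field K] [AddCommGroup J] [Module K J]
    (m : J →ₗ[K] J →ₗ[K] J) {f₁ f₂ g₁ g₂ : J} (hf : LinearIndependent K ![f₁, f₂])
    (f11 : m f₁ f₁ = f₁) (f12 : m f₁ f₂ = 0) (f21 : m f₂ f₁ = 0) (f22 : m f₂ f₂ = f₂)
    (hg : LinearIndependent K ![g₁, g₂])
    (g11 : m g₁ g₁ = g₁) (g12 : m g₁ g₂ = 0) (g22 : m g₂ g₂ = g₂)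
    (hg₁ : g₁ ∈ span K {f₁, f₂}) (hg₂ : g₂ ∈ span K {f₁, f₂}) :
    (g₁ = f₁ ∧ g₂ = f₂) ∨ (g₁ = f₂ ∧ g₂ = f₁) := by
  obtain ⟨x, y, rfl⟩ := mem_span_pair.1 hg₁
  obtain ⟨z, t, rfl⟩ := mem_span_pair.1 hg₂
  have hn₁ : x • f₁ + y • f₂ ≠ 0 := hg.ne_zero 0
  have hn₂ : z • f₁ + t • f₂ ≠ 0 := hg.ne_zero 1
  have mul_eq (a b c d : K) :
      m (a • f₁ + b • f₂) (c • f₁ + d • f₂) = (a * c) • f₁ + (b * d) • f₂ := by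
    simp [f11, f12, f21, f22, smul_smul]
  have coeff (a b c d : K) (h : a • f₁ + b • f₂ = c • f₁ + d • f₂) : a = c ∧ b = d := by
    have := LinearIndependent.pair_iff.1 hf (a - c) (b - d)
      (by rw [← sub_eq_zero] at h; rw [← h]; module)
    exact ⟨sub_eq_zero.1 this.1, sub_eq_zero.1 this.2⟩
  have idem {a : K} (h : a * a = a) : a = 0 ∨ a = 1 := by
    rcases eq_or_ne a 0 with h0 | h0
    · exact .inl h0
    · exact .inr (mul_left_cancel₀ h0 (by simpa using h))
  rw [mul_eq] at g11 g12 g22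
  obtain ⟨hx, hy⟩ := coeff _ _ _ _ g11
  obtain ⟨hz, ht⟩ := coeff _ _ _ _ g22
  obtain ⟨hxz, hyt⟩ := coeff _ _ 0 0 (by simpa using g12)
  rcases idem hx with rfl | rfl <;> rcases idem hy with rfl | rfl <;>
    rcases idem hz with rfl | rfl <;> rcases idem ht with rfl | rfl <;>
    simp at hxz hyt hn₁ hn₂ ⊢

namespace JordanSuperalgebra

variable {K J : Type*} [Field K] [AddCommGroup J] [Module K J] (S : JordanSuperalgebra K J)

theorem mul_comm_of_mem_J0_of_mem_J1 {a b : J} (ha : a ∈ S.J0) (hb : b ∈ S.J1) :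
    S.mul b a = S.mul a b := by
  simpa [sgn] using S.supercomm true false b hb a ha

theorem mul_self_of_mem_J1 (h2 : (2 : K) ≠ 0) {a : J} (ha : a ∈ S.J1) : S.mul a a = 0 := by
  have h : S.mul a a = -S.mul a a := by simpa [sgn] using S.supercomm true true a ha a ha
  have h' : (2 : K) • S.mul a a = 0 := by
    rw [two_smul]
    nth_rewrite 1 [h]
    exact neg_add_cancel _
  exact (smul_eq_zero.1 h').resolve_left h2

/-- An even idempotent acts on an odd eigenvector with eigenvalue `0`, `1/2` or `1`. -/
theorem eigenvalue_of_idempotent_s17 (h2 : (2 : K) ≠ 0) {e w : J} (he : e ∈ S.J0) (hw : w ∈ S.J1)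
    (hw0 : w ≠ 0) (hee : S.mul e e = e) {α : K} (h : S.mul e w = α • w) :
    α = 0 ∨ α = 1 / 2 ∨ α = 1 := by
  have h' := (S.mul_comm_of_mem_J0_of_mem_J1 he hw).trans h
  have key := S.superJordan false false false true e he e he e he w hw
  simp only [sgn, Bool.and_true, Bool.and_false, Bool.false_eq_true, if_false,
    mul_one, hee, h, h', map_smul, LinearMap.smul_apply, smul_smul] at key
  have hz : (α * (1 - 2 * α) * (α - 1)) • w = 0 := by
    rw [← sub_eq_zero.2 key]
    module
  rcases mul_eq_zero.1 ((smul_eq_zero.1 hz).resolve_right hw0) with h0 | h0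
  · rcases mul_eq_zero.1 h0 with h0 | h0
    · exact .inl h0
    · right; left
      rw [eq_div_iff h2]
      linear_combination -h0
  · exact .inr (.inr (sub_eq_zero.1 h0))

/-- If orthogonal even elements, the first of them idempotent, both act nontrivially on an odd
common eigenvector, then the idempotent has eigenvalue `1/2`. -/
theorem eigenvalue_mul_eq_zero_of_orthogonal {e f w : J} (he : e ∈ S.J0)
    (hf : f ∈ S.J0) (hw : w ∈ S.J1) (hw0 : w ≠ 0) (hee : S.mul e e = e) (hef : S.mul e f = 0)
    {α β : K} (h : S.mul e w = α • w) (h' : S.mul f w = β • w) :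
    α * β * (1 - 2 * α) = 0 := by
  have hwe := (S.mul_comm_of_mem_J0_of_mem_J1 he hw).trans h
  have hwf := (S.mul_comm_of_mem_J0_of_mem_J1 hf hw).trans h'
  have key := S.superJordan false false false true e he e he f hf w hw
  simp only [sgn, Bool.and_true, Bool.and_false, Bool.false_eq_true, if_false,
    mul_one, hee, hef, h, h', hwe, hwf, map_smul, LinearMap.smul_apply, smul_smul,
    map_zero, LinearMap.zero_apply, smul_zero, add_zero, zero_add] at key
  refine (smul_eq_zero.1 (?_ : (α * β * (1 - 2 * α)) • w = 0)).resolve_right hw0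
  rw [← sub_eq_zero.2 key]
  module

end JordanSuperalgebra

/-- Classification of Jordan superalgebras of type `(2,1)` whose even
part is `U₁ ⊕ U₁` (two orthogonal idempotents), over an algebraically closed field of
characteristic ≠ 2: exactly one of the tables `(e₁o₁, e₂o₁) = (a·o₁, b·o₁)` with
`(a, b) ∈ {(0,0), (1/2,0), (1,0), (1/2,1/2)}` is realized by a homogeneous basis;
the last one is the indecomposable superalgebra `S₁₃³`. -/
theorem classification_type_two_one_U1U1 (K : Type) [Field K] [IsAlgClosed K]
    (h2 : (2 : K) ≠ 0)
    (J : Type) [AddCommGroup J] [Module K J] (S : JordanSuperalgebra K J)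
    (e₁ e₂ o₁ : J)
    (hJ0 : S.J0 = Submodule.span K {e₁, e₂}) (hli : LinearIndependent K ![e₁, e₂])
    (hJ1 : S.J1 = Submodule.span K {o₁}) (ho : o₁ ≠ 0)
    (h11 : S.mul e₁ e₁ = e₁) (h12 : S.mul e₁ e₂ = 0)
    (h21 : S.mul e₂ e₁ = 0) (h22 : S.mul e₂ e₂ = e₂) :
    ∃! p : Fin 4, ∃ f₁ f₂ w : J,
      S.J0 = Submodule.span K {f₁, f₂} ∧ LinearIndependent K ![f₁, f₂] ∧
      S.J1 = Submodule.span K {w} ∧ w ≠ 0 ∧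
      S.mul f₁ f₁ = f₁ ∧ S.mul f₁ f₂ = 0 ∧ S.mul f₂ f₁ = 0 ∧ S.mul f₂ f₂ = f₂ ∧
      S.mul f₁ w = (![(0 : K), 1/2, 1, 1/2] p) • w ∧
      S.mul w f₁ = (![(0 : K), 1/2, 1, 1/2] p) • w ∧
      S.mul f₂ w = (![(0 : K), 0, 0, 1/2] p) • w ∧
      S.mul w f₂ = (![(0 : K), 0, 0, 1/2] p) • w ∧
      S.mul w w = 0 := by
  have he₁ : e₁ ∈ S.J0 := hJ0 ▸ Submodule.subset_span (by simp)
  have he₂ : e₂ ∈ S.J0 := hJ0 ▸ Submodule.subset_span (by simp)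
  have ho₁ : o₁ ∈ S.J1 := hJ1 ▸ Submodule.mem_span_singleton_self o₁
  have hone : (1 : K) / 2 ≠ 1 := by
    intro h
    rw [div_eq_iff h2] at h
    exact one_ne_zero (α := K) (by linear_combination -h)
  have hhalf : (1 : K) / 2 ≠ 0 := one_div_ne_zero h2
  refine existsUnique_of_exists_of_unique ?_ ?_
  · obtain ⟨α, hα⟩ := Submodule.mem_span_singleton.1
      (hJ1 ▸ S.grade false true e₁ he₁ o₁ ho₁ : S.mul e₁ o₁ ∈ Submodule.span K {o₁})
    obtain ⟨β, hβ⟩ := Submodule.mem_span_singleton.1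
      (hJ1 ▸ S.grade false true e₂ he₂ o₁ ho₁ : S.mul e₂ o₁ ∈ Submodule.span K {o₁})
    have hα' := (S.mul_comm_of_mem_J0_of_mem_J1 he₁ ho₁).trans hα.symm
    have hβ' := (S.mul_comm_of_mem_J0_of_mem_J1 he₂ ho₁).trans hβ.symm
    have hoo := S.mul_self_of_mem_J1 h2 ho₁
    have hαβ := S.eigenvalue_mul_eq_zero_of_orthogonal he₁ he₂ ho₁ ho h11 h12 hα.symm hβ.symm
    have hβα := S.eigenvalue_mul_eq_zero_of_orthogonal he₂ he₁ ho₁ ho h22 h21 hβ.symm hα.symm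
    have hp : ∃ p : Fin 4, (α = ![(0 : K), 1/2, 1, 1/2] p ∧ β = ![(0 : K), 0, 0, 1/2] p) ∨
        (β = ![(0 : K), 1/2, 1, 1/2] p ∧ α = ![(0 : K), 0, 0, 1/2] p) := by
      rcases S.eigenvalue_of_idempotent_s17 h2 he₁ ho₁ ho h11 hα.symm with h | h | h <;>
        rcases S.eigenvalue_of_idempotent_s17 h2 he₂ ho₁ ho h22 hβ.symm with h' | h' | h'
      · exact ⟨0, .inl ⟨h, h'⟩⟩
      · exact ⟨1, .inr ⟨h', h⟩⟩
      · exact ⟨2, .inr ⟨h', h⟩⟩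
      · exact ⟨1, .inl ⟨h, h'⟩⟩
      · exact ⟨3, .inl ⟨h, h'⟩⟩
      · rw [h, h'] at hβα
        norm_num [h2] at hβα
      · exact ⟨2, .inl ⟨h, h'⟩⟩
      · rw [h, h'] at hαβ
        norm_num [h2] at hαβ
      · rw [h, h'] at hαβ
        norm_num at hαβ
    obtain ⟨p, ⟨hp, hp'⟩ | ⟨hp, hp'⟩⟩ := hp
    · refine ⟨p, e₁, e₂, o₁, hJ0, hli, hJ1, ho, h11, h12, h21, h22, ?_⟩
      rw [← hp, ← hp']
      exact ⟨hα.symm, hα', hβ.symm, hβ', hoo⟩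
    · refine ⟨p, e₂, e₁, o₁, by rw [hJ0, Set.pair_comm], LinearIndependent.pair_symm_iff.1 hli,
        hJ1, ho, h22, h21, h12, h11, ?_⟩
      rw [← hp, ← hp']
      exact ⟨hβ.symm, hβ', hα.symm, hα', hoo⟩
  · rintro p q ⟨f₁, f₂, w, hf0, hf, hf1, hw, f11, f12, f21, f22, f1w, -, f2w, -, -⟩
      ⟨g₁, g₂, v, hg0, hg, hg1, hv, g11, g12, -, g22, g1v, -, g2v, -, -⟩
    obtain ⟨c, rfl⟩ := Submodule.mem_span_singleton.1
      (hf1 ▸ hg1 ▸ Submodule.mem_span_singleton_self v : v ∈ Submodule.span K {w})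
    have hspan : Submodule.span K {g₁, g₂} = Submodule.span K {f₁, f₂} := hg0.symm.trans hf0
    have eigen {a b : K} {f : J} (h : S.mul f w = a • w)
        (h' : S.mul f (c • w) = b • c • w) : a = b := by
      rw [map_smul, h, smul_comm c a] at h'
      exact smul_left_injective K hv h'
    rcases eq_or_swap_of_orthogonal_idempotents S.mul hf f11 f12 f21 f22 hg g11 g12 g22
      (hspan ▸ Submodule.subset_span (by simp)) (hspan ▸ Submodule.subset_span (by simp))
      with ⟨rfl, rfl⟩ | ⟨rfl, rfl⟩
    · have h₁ := eigen f1w g1v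
      have h₂ := eigen f2w g2v
      clear * - h₁ h₂ hone hhalf
      fin_cases p <;> fin_cases q <;> simp_all [eq_comm]
    · have h₁ := eigen f1w g2v
      have h₂ := eigen f2w g1v
      clear * - h₁ h₂ hone hhalf
      fin_cases p <;> fin_cases q <;> simp_all [eq_comm]
end
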